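/- Let two agents 1 (Alice) and 2 (Bob) have monotonic valuations u_1, u_2 over the connected bundles of a path v_1,…,v_m, and let v_j be Alice's lumpy tie, i.e., the smallest index j with u_1(L(v_j) ∪ {v_j}) ≥ u_1(R(v_j)) and u_1(R(v_j) ∪ {v_j}) ≥ u_1(L(v_j)). Then the allocation in which Bob receives a bundle he weakly prefers among L(v_j) and R(v_j) (so u_2 of his bundle is at least u_2 of the other), and Alice receives all remaining items including v_j, is a connected EF1 allocation. In particular, on a path a connected EF1 allocation for two agents always exists. -/

import Mathlib

/-- A bundle of items on a path `v_1, …, v_m` (modeled as `Fin m`) is connected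
iff it is an interval (possibly empty). -/
def IsInterval {m : ℕ} (I : Finset (Fin m)) : Prop :=
  ∀ a b c : Fin m, a ≤ b → b ≤ c → a ∈ I → c ∈ I → b ∈ I

/-- A valuation is monotonic if larger bundles are weakly better. -/
def Monotonic {m : ℕ} (u : Finset (Fin m) → ℝ) : Prop :=
  ∀ X Y : Finset (Fin m), X ⊆ Y → u X ≤ u Y

/-- A connected allocation on a path: every bundle is an interval, bundles are pairwise
disjoint, and every item belongs to some bundle. -/
def IsConnAlloc {n m : ℕ} (A : Fin n → Finset (Fin m)) : Prop :=
  (∀ i, IsInterval (A i)) ∧ (∀ i j, i ≠ j → Disjoint (A i) (A j)) ∧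
    ∀ v : Fin m, ∃ i, v ∈ A i

/-- EF1 (envy-freeness up to one outer good) on a path. -/
def EF1 {n m : ℕ} (u : Fin n → Finset (Fin m) → ℝ) (A : Fin n → Finset (Fin m)) : Prop :=
  ∀ i j : Fin n, A j = ∅ ∨
    ∃ v ∈ A j, IsInterval (A j \ {v}) ∧ u i (A j \ {v}) ≤ u i (A i)

/-- Removing the first item of an interval leaves an interval. -/
theorem IsInterval.sdiff_min {m : ℕ} {I : Finset (Fin m)} (hI : IsInterval I) (h : I.Nonempty) :
    IsInterval (I \ {I.min' h}) := by
  intro a b c hab hbc ha hc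
  simp only [Finset.mem_sdiff, Finset.mem_singleton] at ha hc ⊢
  refine ⟨hI a b c hab hbc ha.1 hc.1, fun hb => ha.2 ?_⟩
  exact le_antisymm (hb ▸ hab) (I.min'_le a ha.1)

/-- An agent who weakly prefers `Y` to the interval `X` does not envy the owner of `X`
up to one outer good. -/
theorem IsInterval.eq_empty_or_exists_sdiff_le {m : ℕ} {u : Finset (Fin m) → ℝ}
    (hu : Monotonic u) {X Y : Finset (Fin m)} (hX : IsInterval X) (h : u X ≤ u Y) :
    X = ∅ ∨ ∃ v ∈ X, IsInterval (X \ {v}) ∧ u (X \ {v}) ≤ u Y := by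
  rcases X.eq_empty_or_nonempty with hE | hN
  · exact Or.inl hE
  · exact Or.inr ⟨X.min' hN, X.min'_mem hN, hX.sdiff_min hN,
      (hu _ _ Finset.sdiff_subset).trans h⟩

theorem isInterval_Iio {m : ℕ} (j : Fin m) : IsInterval (Finset.Iio j) := by
  intro a b c _ hbc _ hc
  exact Finset.mem_Iio.2 (hbc.trans_lt (Finset.mem_Iio.1 hc))

theorem isInterval_Ioi {m : ℕ} (j : Fin m) : IsInterval (Finset.Ioi j) := by
  intro a b c hab _ ha _
  exact Finset.mem_Ioi.2 ((Finset.mem_Ioi.1 ha).trans_le hab)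

theorem isInterval_insert_Iio {m : ℕ} (j : Fin m) : IsInterval (insert j (Finset.Iio j)) := by
  intro a b c _ hbc _ hc
  rw [Finset.Iio_insert, Finset.mem_Iic] at hc ⊢
  exact hbc.trans hc

theorem isInterval_insert_Ioi {m : ℕ} (j : Fin m) : IsInterval (insert j (Finset.Ioi j)) := by
  intro a b c hab _ ha _
  rw [Finset.Ioi_insert, Finset.mem_Ici] at ha ⊢
  exact ha.trans hab

/-- Cutting the path next to `j`: if Bob weakly prefers the interval `B` to the interval `C`,
and Alice weakly prefers `C` together with `j` to `B`, then giving `B` to Bob and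
the rest to Alice is a connected EF1 allocation. -/
theorem isConnAlloc_and_EF1_of_cut {m : ℕ} {u : Fin 2 → Finset (Fin m) → ℝ}
    (hmono : ∀ i, Monotonic (u i)) {j : Fin m} {B C : Finset (Fin m)}
    (hB : IsInterval B) (hC : IsInterval C) (hjC : IsInterval (insert j C)) (hj : j ∉ C)
    (hcompl : Finset.univ \ B = insert j C)
    (hAlice : u 0 B ≤ u 0 (insert j C)) (hBob : u 1 C ≤ u 1 B) :
    IsConnAlloc ![Finset.univ \ B, B] ∧ EF1 u ![Finset.univ \ B, B] := by
  refine ⟨⟨?_, ?_, ?_⟩, ?_⟩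
  · rw [hcompl, Fin.forall_fin_two]
    exact ⟨hjC, hB⟩
  · simp [Fin.forall_fin_two, Finset.sdiff_disjoint, Finset.disjoint_sdiff]
  · intro v
    by_cases hv : v ∈ B
    · exact ⟨1, hv⟩
    · exact ⟨0, by simp [hv]⟩
  · rw [hcompl]
    simp only [EF1, Fin.forall_fin_two]
    refine ⟨⟨hjC.eq_empty_or_exists_sdiff_le (hmono 0) le_rfl,
      hB.eq_empty_or_exists_sdiff_le (hmono 0) hAlice⟩, Or.inr ⟨j, ?_, ?_⟩,
      hB.eq_empty_or_exists_sdiff_le (hmono 1) le_rfl⟩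
    · exact Finset.mem_insert_self j C
    · have h : insert j C \ {j} = C := by
        rw [Finset.sdiff_singleton_eq_erase, Finset.erase_insert hj]
      change IsInterval (insert j C \ {j}) ∧ u 1 (insert j C \ {j}) ≤ u 1 B
      rw [h]
      exact ⟨hC, hBob⟩

/-- two agents, Alice = agent 0 and Bob = agent 1, with monotonic valuations
on a path with `m ≥ 1` items. If `j` is Alice's lumpy tie (the smallest index with
`u₀(L(v_j) ∪ {v_j}) ≥ u₀(R(v_j))` and `u₀(R(v_j) ∪ {v_j}) ≥ u₀(L(v_j))`) and Bob receives a
weakly preferred bundle `B` among `L(v_j)` and `R(v_j)` while Alice receives all remaining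
items (including `v_j`), the resulting allocation is a connected EF1 allocation.
In particular, a connected EF1 allocation for two agents exists. -/
theorem discrete_cut_and_choose_EF1 {m : ℕ} (hm : 1 ≤ m)
    (u : Fin 2 → Finset (Fin m) → ℝ)
    (hmono : ∀ i, Monotonic (u i)) (h0 : ∀ i, u i ∅ = 0)
    (j : Fin m)
    (hj : u 0 (Finset.Ioi j) ≤ u 0 (insert j (Finset.Iio j)) ∧
          u 0 (Finset.Iio j) ≤ u 0 (insert j (Finset.Ioi j)))
    (hleast : ∀ k : Fin m,
        (u 0 (Finset.Ioi k) ≤ u 0 (insert k (Finset.Iio k)) ∧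
         u 0 (Finset.Iio k) ≤ u 0 (insert k (Finset.Ioi k))) → j ≤ k)
    (B : Finset (Fin m))
    (hB : (B = Finset.Iio j ∧ u 1 (Finset.Ioi j) ≤ u 1 B) ∨
          (B = Finset.Ioi j ∧ u 1 (Finset.Iio j) ≤ u 1 B)) :
    (IsConnAlloc ![Finset.univ \ B, B] ∧ EF1 u ![Finset.univ \ B, B]) ∧
      ∃ A : Fin 2 → Finset (Fin m), IsConnAlloc A ∧ EF1 u A := by
  have key : IsConnAlloc ![Finset.univ \ B, B] ∧ EF1 u ![Finset.univ \ B, B] := by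
    rcases hB with ⟨rfl, hBob⟩ | ⟨rfl, hBob⟩
    · refine isConnAlloc_and_EF1_of_cut hmono (isInterval_Iio j) (isInterval_Ioi j)
        (isInterval_insert_Ioi j) (by simp) ?_ hj.2 hBob
      ext v
      simp
    · refine isConnAlloc_and_EF1_of_cut hmono (isInterval_Ioi j) (isInterval_Iio j)
        (isInterval_insert_Iio j) (by simp) ?_ hj.1 hBob
      ext v
      simp
  exact ⟨key, _, key⟩
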